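/- Let N ≥ 2 and let ψ_1, …, ψ_N be unit vectors in ℂ^d with ⟨ψ_i, ψ_j⟩ = c for all i ≠ j, where c is real with 0 < c < 1. Then the matrices γ1 = N⁻² Σ_k P_k ⊗ P_k and γ2 = N⁻² Σ_{k≠l} P_k ⊗ P_l admit a two-dimensional common block-diagonal structure (2d-CBS), i.e., there exists a finite family {Π_k} of pairwise orthogonal self-adjoint projections on ℂ^{d²} summing to the identity, each of rank at most 2, such that every Π_k commutes with γ1 and with γ2. Hence the symmetric unambiguous state comparison 'two out of N' reduces to pure-state discrimination problems in dimension at most two. -/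

import Mathlib

open Matrix Kronecker

/-- The rank-one projection `ψ ψ†` onto the span of the unit vector `ψ k`. -/
noncomputable def projOf {d N : ℕ} (ψ : Fin N → Fin d → ℂ) (k : Fin N) :
    Matrix (Fin d) (Fin d) ℂ :=
  Matrix.vecMulVec (ψ k) (star (ψ k))

/-- `γ1 = N⁻² ∑ k, P k ⊗ P k`, describing a pair of identical states. -/
noncomputable def gammaOne {d N : ℕ} (ψ : Fin N → Fin d → ℂ) :
    Matrix (Fin d × Fin d) (Fin d × Fin d) ℂ :=
  ((N : ℂ) ^ 2)⁻¹ • ∑ k, projOf ψ k ⊗ₖ projOf ψ k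

/-- `γ2 = N⁻² ∑ k ≠ l, P k ⊗ P l`, describing a pair of distinct states. -/
noncomputable def gammaTwo {d N : ℕ} (ψ : Fin N → Fin d → ℂ) :
    Matrix (Fin d × Fin d) (Fin d × Fin d) ℂ :=
  ((N : ℂ) ^ 2)⁻¹ • ∑ p ∈ Finset.univ.filter (fun p : Fin N × Fin N => p.1 ≠ p.2),
    projOf ψ p.1 ⊗ₖ projOf ψ p.2

section Operators

variable {E : Type*} [NormedAddCommGroup E] [InnerProductSpace ℂ E]

theorem inf_orthogonal_invariant {K L : Submodule ℂ E} {A : E →ₗ[ℂ] E} (hA : A.IsSymmetric)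
    (hK : ∀ x ∈ K, A x ∈ K) (hL : ∀ x ∈ L, A x ∈ L) : ∀ x ∈ Lᗮ ⊓ K, A x ∈ Lᗮ ⊓ K := by
  rintro x ⟨hxL, hxK⟩
  refine ⟨(Submodule.mem_orthogonal L _).2 fun u hu => ?_, hK x hxK⟩
  rw [← hA u x]
  exact (Submodule.mem_orthogonal L x).1 hxL _ (hL u hu)

/-- If every nonzero common invariant subspace of two symmetric operators contains a nonzero common
invariant subspace of dimension at most `2`, then every common invariant subspace is an orthogonal
sum of such subspaces. -/
theorem exists_orthogonal_invariant_decomposition [FiniteDimensional ℂ E] {A B : E →ₗ[ℂ] E}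
    (hA : A.IsSymmetric) (hB : B.IsSymmetric)
    (h : ∀ K : Submodule ℂ E, K ≠ ⊥ → (∀ x ∈ K, A x ∈ K) → (∀ x ∈ K, B x ∈ K) →
      ∃ L ≤ K, L ≠ ⊥ ∧ (∀ x ∈ L, A x ∈ L) ∧ (∀ x ∈ L, B x ∈ L) ∧ Module.finrank ℂ L ≤ 2)
    (K : Submodule ℂ E) (hKA : ∀ x ∈ K, A x ∈ K) (hKB : ∀ x ∈ K, B x ∈ K) :
    ∃ (m : ℕ) (U : Fin m → Submodule ℂ E), (∀ i j, i ≠ j → U i ⟂ U j) ∧ ⨆ i, U i = K ∧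
      ∀ i, (∀ x ∈ U i, A x ∈ U i) ∧ (∀ x ∈ U i, B x ∈ U i) ∧ Module.finrank ℂ (U i) ≤ 2 := by
  induction hn : Module.finrank ℂ K using Nat.strong_induction_on generalizing K with
  | _ n ih =>
    by_cases hK : K = ⊥
    · exact ⟨0, Fin.elim0, fun i => i.elim0, by simp [hK], fun i => i.elim0⟩
    obtain ⟨L, hLK, hL, hLA, hLB, hL2⟩ := h K hK hKA hKB
    have hdim := Submodule.finrank_add_inf_finrank_orthogonal hLK
    have hpos : 0 < Module.finrank ℂ L :=
      Nat.pos_of_ne_zero fun h0 => hL (Submodule.finrank_eq_zero.1 h0)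
    obtain ⟨m, U, hU, hsup, hinv⟩ := ih _ (by omega) (Lᗮ ⊓ K)
      (inf_orthogonal_invariant hA hKA hLA) (inf_orthogonal_invariant hB hKB hLB) rfl
    have hUL : ∀ i, L ⟂ U i := fun i =>
      (Submodule.isOrtho_orthogonal_right L).mono_right
        ((le_iSup U i).trans (hsup.le.trans inf_le_left))
    refine ⟨m + 1, Fin.cons L U, ?_, ?_, ?_⟩
    · intro i j
      refine Fin.cases ?_ (fun i => ?_) i <;> refine Fin.cases ?_ (fun j => ?_) j
      · simp
      · exact fun _ => hUL j
      · exact fun _ => (hUL i).symm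
      · simpa using hU i j
    · rw [← (finSuccEquiv m).symm.iSup_comp, iSup_option]
      simp only [finSuccEquiv_symm_none, finSuccEquiv_symm_some, Fin.cons_zero, Fin.cons_succ, hsup]
      exact Submodule.sup_orthogonal_inf_of_hasOrthogonalProjection hLK
    · exact fun i => Fin.cases ⟨hLA, hLB, hL2⟩ hinv i

theorem commute_starProjection_of_invariant [FiniteDimensional ℂ E] {K : Submodule ℂ E}
    {A : E →L[ℂ] E} (hA : (A : E →ₗ[ℂ] E).IsSymmetric) (hK : ∀ x ∈ K, A x ∈ K) :
    Commute K.starProjection A := by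
  rw [ContinuousLinearMap.IsIdempotentElem.commute_iff K.isIdempotentElem_starProjection,
    Submodule.range_starProjection, Submodule.ker_starProjection]
  refine ⟨hK, fun x hx => ?_⟩
  have := inf_orthogonal_invariant (K := ⊤) (L := K) hA (by simp) hK x (by simpa using hx)
  simpa using this

end Operators

/-- Two Hermitian matrices have a common block-diagonal structure with blocks of size at most `2`
as soon as every nonzero common invariant subspace contains a nonzero vector `x` and a vector `y`
whose span is invariant. -/
theorem exists_commuting_projections_of_invariant_pairs {n : Type*} [Fintype n] [DecidableEq n]
    {A B : Matrix n n ℂ} (hA : A.IsHermitian) (hB : B.IsHermitian)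
    (h : ∀ K : Submodule ℂ (n → ℂ), K ≠ ⊥ → (∀ x ∈ K, A *ᵥ x ∈ K) → (∀ x ∈ K, B *ᵥ x ∈ K) →
      ∃ x ∈ K, ∃ y ∈ K, x ≠ 0 ∧
        A *ᵥ x ∈ Submodule.span ℂ {x, y} ∧ A *ᵥ y ∈ Submodule.span ℂ {x, y} ∧
        B *ᵥ x ∈ Submodule.span ℂ {x, y} ∧ B *ᵥ y ∈ Submodule.span ℂ {x, y}) :
    ∃ (m : ℕ) (Q : Fin m → Matrix n n ℂ),
      (∀ k, (Q k).IsHermitian) ∧ (∀ k, Q k * Q k = Q k) ∧ (∀ k l, k ≠ l → Q k * Q l = 0) ∧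
      (∑ k, Q k = 1) ∧ (∀ k, (Q k).rank ≤ 2) ∧ (∀ k, Commute (Q k) A) ∧
      (∀ k, Commute (Q k) B) := by
  let Φ := Matrix.toEuclideanCLM (n := n) (𝕜 := ℂ)
  let e : EuclideanSpace ℂ n ≃ₗ[ℂ] (n → ℂ) := WithLp.linearEquiv 2 ℂ (n → ℂ)
  have hsymm : ∀ {M : Matrix n n ℂ}, M.IsHermitian →
      ((Φ M : EuclideanSpace ℂ n →L[ℂ] EuclideanSpace ℂ n) :
        EuclideanSpace ℂ n →ₗ[ℂ] EuclideanSpace ℂ n).IsSymmetric := fun {M} hM =>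
    Matrix.isSymmetric_toEuclideanLin_iff.2 hM
  have hspan : ∀ {M : Matrix n n ℂ} {x y : n → ℂ}, M *ᵥ x ∈ Submodule.span ℂ {x, y} →
      M *ᵥ y ∈ Submodule.span ℂ {x, y} →
      ∀ z ∈ (Submodule.span ℂ {x, y}).comap (e : EuclideanSpace ℂ n →ₗ[ℂ] (n → ℂ)),
        Φ M z ∈ (Submodule.span ℂ {x, y}).comap (e : EuclideanSpace ℂ n →ₗ[ℂ] (n → ℂ)) := by
    intro M x y hx hy z hz
    obtain ⟨a, b, hab⟩ := Submodule.mem_span_pair.1 (Submodule.mem_comap.1 hz)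
    have : e (Φ M z) = a • M *ᵥ x + b • M *ᵥ y := by
      rw [← Matrix.mulVec_smul, ← Matrix.mulVec_smul, ← Matrix.mulVec_add, hab]
      rfl
    rw [Submodule.mem_comap]
    change e (Φ M z) ∈ _
    rw [this]
    exact add_mem (Submodule.smul_mem _ _ hx) (Submodule.smul_mem _ _ hy)
  obtain ⟨m, U, hU, hsup, hinv⟩ := exists_orthogonal_invariant_decomposition
    (hsymm hA) (hsymm hB) (fun K hK hKA hKB => by
      obtain ⟨x, hx, y, hy, hx0, hAx, hAy, hBx, hBy⟩ :=
        h (K.comap (e.symm : (n → ℂ) →ₗ[ℂ] EuclideanSpace ℂ n))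
          (fun h0 => hK <| by
            rw [Submodule.eq_bot_iff] at h0 ⊢
            exact fun z hz => e.map_eq_zero_iff.1 (h0 (e z) (by simpa using hz)))
          (fun x hx => hKA _ hx) (fun x hx => hKB _ hx)
      refine ⟨(Submodule.span ℂ {x, y}).comap (e : EuclideanSpace ℂ n →ₗ[ℂ] (n → ℂ)), ?_, ?_,
        hspan hAx hAy, hspan hBx hBy, ?_⟩
      · intro z hz
        obtain ⟨a, b, hab⟩ := Submodule.mem_span_pair.1 (Submodule.mem_comap.1 hz)
        have : z = a • e.symm x + b • e.symm y := by
          apply e.injective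
          simpa using hab.symm
        rw [this]
        exact add_mem (K.smul_mem _ hx) (K.smul_mem _ hy)
      · intro h0
        rw [Submodule.eq_bot_iff] at h0
        have := h0 (e.symm x) (by simpa using Submodule.subset_span (by simp))
        exact hx0 (e.symm.map_eq_zero_iff.1 this)
      · rw [Submodule.comap_equiv_eq_map_symm, LinearEquiv.finrank_map_eq]
        have := finrank_span_finset_le_card (R := ℂ) ({x, y} : Finset (n → ℂ))
        rw [Finset.coe_pair] at this
        exact this.trans Finset.card_le_two) ⊤ (by simp) (by simp)
  have hΦ : ∀ k, Φ (Φ.symm (U k).starProjection) = (U k).starProjection :=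
    fun k => Φ.apply_symm_apply _
  refine ⟨m, fun k => Φ.symm (U k).starProjection, fun k => ?_, fun k => ?_, fun k l hkl => ?_,
    ?_, fun k => ?_, fun k => ?_, fun k => ?_⟩
  · refine Matrix.isSymmetric_toEuclideanLin_iff.1 ?_
    rw [← Matrix.coe_toEuclideanCLM_eq_toEuclideanLin]
    change ((Φ (Φ.symm (U k).starProjection) : EuclideanSpace ℂ n →L[ℂ] EuclideanSpace ℂ n) :
      EuclideanSpace ℂ n →ₗ[ℂ] EuclideanSpace ℂ n).IsSymmetric
    rw [hΦ]
    exact (U k).starProjection_isSymmetric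
  · rw [← map_mul, (U k).isIdempotentElem_starProjection.eq]
  · rw [← map_mul]
    exact (congrArg Φ.symm (hU k l hkl).starProjection_comp_starProjection).trans (map_zero _)
  · rw [← map_sum, ← map_one Φ.symm]
    congr 1
    ext1 x
    have horth : OrthogonalFamily ℂ (fun i => U i) fun i => (U i).subtypeₗᵢ :=
      OrthogonalFamily.of_pairwise fun i j hij => hU i j hij
    simpa using horth.sum_projection_of_mem_iSup x (by simp [hsup])
  · rw [Matrix.rank_eq_finrank_range_toLin _ (EuclideanSpace.basisFun n ℂ).toBasis
      (EuclideanSpace.basisFun n ℂ).toBasis, ← Matrix.toEuclideanLin_eq_toLin_orthonormal,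
      ← Matrix.coe_toEuclideanCLM_eq_toEuclideanLin]
    change Module.finrank ℂ (Φ (Φ.symm (U k).starProjection)).range ≤ 2
    rw [hΦ, Submodule.range_starProjection]
    exact (hinv k).2.2
  · refine (commute_map_iff (f := Φ) Φ.injective).1 ?_
    rw [hΦ]
    exact commute_starProjection_of_invariant (hsymm hA) (hinv k).1
  · refine (commute_map_iff (f := Φ) Φ.injective).1 ?_
    rw [hΦ]
    exact commute_starProjection_of_invariant (hsymm hB) (hinv k).2.1

theorem exists_eigenvector_mem {n : Type*} [Fintype n] {B : Matrix n n ℂ}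
    {K : Submodule ℂ (n → ℂ)} (hK : K ≠ ⊥) (hKB : ∀ x ∈ K, B *ᵥ x ∈ K) :
    ∃ x ∈ K, x ≠ 0 ∧ ∃ μ : ℂ, B *ᵥ x = μ • x := by
  have : Nontrivial K := Submodule.nontrivial_iff_ne_bot.2 hK
  obtain ⟨μ, hμ⟩ := Module.End.exists_eigenvalue (B.mulVecLin.restrict hKB)
  obtain ⟨x, hx⟩ := hμ.exists_hasEigenvector
  exact ⟨x, x.2, fun h => hx.2 (Subtype.ext h), μ, congrArg Subtype.val hx.apply_eq_smul⟩

section StateComparison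

variable {d N : ℕ}

/-- The Kronecker product of two vectors, as a bilinear map. -/
def kroneckerVec : (Fin d → ℂ) →ₗ[ℂ] (Fin d → ℂ) →ₗ[ℂ] (Fin d × Fin d → ℂ) :=
  LinearMap.mk₂ ℂ (fun x y p => x p.1 * y p.2)
    (fun _ _ _ => by ext; simp [add_mul]) (fun _ _ _ => by ext; simp [mul_assoc])
    (fun _ _ _ => by ext; simp [mul_add]) (fun _ _ _ => by ext; simp [mul_left_comm])

theorem kroneckerVec_apply (x y : Fin d → ℂ) (p : Fin d × Fin d) :
    kroneckerVec x y p = x p.1 * y p.2 := rfl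

theorem kronecker_mulVec_kroneckerVec (A B : Matrix (Fin d) (Fin d) ℂ) (x y : Fin d → ℂ) :
    (A ⊗ₖ B) *ᵥ kroneckerVec x y = kroneckerVec (A *ᵥ x) (B *ᵥ y) := by
  ext p
  simp only [Matrix.mulVec, dotProduct, kroneckerVec_apply, Matrix.kroneckerMap_apply,
    Finset.sum_mul_sum, Fintype.sum_prod_type]
  exact Finset.sum_congr rfl fun i _ => Finset.sum_congr rfl fun j _ => by ring

theorem star_kroneckerVec_dotProduct (x y z w : Fin d → ℂ) :
    star (kroneckerVec x y) ⬝ᵥ kroneckerVec z w = (star x ⬝ᵥ z) * (star y ⬝ᵥ w) := by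
  simp only [dotProduct, kroneckerVec_apply, Pi.star_apply, star_mul', Finset.sum_mul_sum,
    Fintype.sum_prod_type]
  exact Finset.sum_congr rfl fun i _ => Finset.sum_congr rfl fun j _ => by ring

theorem sum_projOf_mulVec (ψ : Fin N → Fin d → ℂ) (x : Fin d → ℂ) :
    (∑ k, projOf ψ k) *ᵥ x = ∑ k, (star (ψ k) ⬝ᵥ x) • ψ k := by
  simp [Matrix.sum_mulVec, projOf, Matrix.vecMulVec_mulVec]

theorem sum_projOf_kronecker_mulVec (ψ : Fin N → Fin d → ℂ) (z : Fin d × Fin d → ℂ) :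
    (∑ k, projOf ψ k ⊗ₖ projOf ψ k) *ᵥ z =
      ∑ k, (star (kroneckerVec (ψ k) (ψ k)) ⬝ᵥ z) • kroneckerVec (ψ k) (ψ k) := by
  have h : ∀ k, projOf ψ k ⊗ₖ projOf ψ k =
      Matrix.vecMulVec (kroneckerVec (ψ k) (ψ k)) (star (kroneckerVec (ψ k) (ψ k))) := by
    intro k
    ext p q
    simp only [projOf, Matrix.kroneckerMap_apply, Matrix.vecMulVec_apply, kroneckerVec_apply,
      Pi.star_apply, star_mul']
    ring
  simp [Matrix.sum_mulVec, h, Matrix.vecMulVec_mulVec]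

theorem isHermitian_projOf (ψ : Fin N → Fin d → ℂ) (k : Fin N) : (projOf ψ k).IsHermitian := by
  ext i j
  simp [projOf, Matrix.vecMulVec_apply, mul_comm]

theorem isHermitian_sum_projOf (ψ : Fin N → Fin d → ℂ) : (∑ k, projOf ψ k).IsHermitian := by
  rw [Matrix.IsHermitian, Matrix.conjTranspose_sum]
  exact Finset.sum_congr rfl fun k _ => isHermitian_projOf ψ k

theorem isHermitian_sum_projOf_kronecker (ψ : Fin N → Fin d → ℂ) :
    (∑ k, projOf ψ k ⊗ₖ projOf ψ k).IsHermitian := by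
  rw [Matrix.IsHermitian, Matrix.conjTranspose_sum]
  refine Finset.sum_congr rfl fun k _ => ?_
  rw [Matrix.conjTranspose_kronecker, isHermitian_projOf ψ k]

theorem isHermitian_kronecker_sum_projOf (ψ : Fin N → Fin d → ℂ) :
    ((∑ k, projOf ψ k) ⊗ₖ (∑ k, projOf ψ k)).IsHermitian := by
  rw [Matrix.IsHermitian, Matrix.conjTranspose_kronecker, isHermitian_sum_projOf ψ]

theorem gammaTwo_eq (ψ : Fin N → Fin d → ℂ) :
    gammaTwo ψ = ((N : ℂ) ^ 2)⁻¹ • ((∑ k, projOf ψ k) ⊗ₖ (∑ k, projOf ψ k) -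
      ∑ k, projOf ψ k ⊗ₖ projOf ψ k) := by
  have hprod : (∑ k, projOf ψ k) ⊗ₖ (∑ k, projOf ψ k) =
      ∑ p : Fin N × Fin N, projOf ψ p.1 ⊗ₖ projOf ψ p.2 := by
    ext i j
    simp [Matrix.sum_apply, Matrix.kroneckerMap_apply, Finset.sum_mul_sum, Fintype.sum_prod_type]
  have hdiag : ∑ p : Fin N × Fin N with ¬p.1 ≠ p.2, projOf ψ p.1 ⊗ₖ projOf ψ p.2 =
      ∑ k, projOf ψ k ⊗ₖ projOf ψ k := by
    simp [Finset.sum_filter, Fintype.sum_prod_type]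
  rw [gammaTwo, hprod, ← Finset.sum_filter_add_sum_filter_not Finset.univ
    (fun p : Fin N × Fin N => p.1 ≠ p.2), hdiag, add_sub_cancel_right]

theorem star_dotProduct_sum_smul {n : Type*} [Fintype n] {f : Fin N → n → ℂ} {c : ℂ}
    (hf : ∀ i j, star (f i) ⬝ᵥ f j = if i = j then 1 else c) (a : Fin N → ℂ) (k : Fin N) :
    star (f k) ⬝ᵥ ∑ j, a j • f j = c * ∑ j, a j + (1 - c) * a k := by
  have h : ∀ j, a j * (if k = j then 1 else c) = c * a j + if k = j then (1 - c) * a j else 0 := by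
    intro j
    split_ifs <;> ring
  simp [dotProduct_sum, dotProduct_smul, hf, h, Finset.sum_add_distrib, Finset.mul_sum]

variable {ψ : Fin N → Fin d → ℂ} {c : ℂ}

theorem star_kroneckerVec_self_dotProduct
    (hψ : ∀ i j, star (ψ i) ⬝ᵥ ψ j = if i = j then 1 else c)
    (i j : Fin N) :
    star (kroneckerVec (ψ i) (ψ i)) ⬝ᵥ kroneckerVec (ψ j) (ψ j) = if i = j then 1 else c ^ 2 := by
  rw [star_kroneckerVec_dotProduct, hψ]
  split_ifs <;> ring

theorem sum_projOf_mulVec_sum_smul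
    (hψ : ∀ i j, star (ψ i) ⬝ᵥ ψ j = if i = j then 1 else c)
    (a : Fin N → ℂ) :
    (∑ k, projOf ψ k) *ᵥ ∑ j, a j • ψ j =
      (c * ∑ j, a j) • ∑ j, ψ j + (1 - c) • ∑ j, a j • ψ j := by
  rw [sum_projOf_mulVec]
  simp only [star_dotProduct_sum_smul hψ, add_smul, Finset.sum_add_distrib, mul_smul,
    Finset.smul_sum]

theorem sum_projOf_mulVec_sum
    (hψ : ∀ i j, star (ψ i) ⬝ᵥ ψ j = if i = j then 1 else c) :
    (∑ k, projOf ψ k) *ᵥ ∑ j, ψ j = (c * N + (1 - c)) • ∑ j, ψ j := by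
  simpa [add_smul] using sum_projOf_mulVec_sum_smul hψ (fun _ => 1)

theorem sum_projOf_mulVec_self
    (hψ : ∀ i j, star (ψ i) ⬝ᵥ ψ j = if i = j then 1 else c)
    (k : Fin N) :
    (∑ k, projOf ψ k) *ᵥ ψ k = c • ∑ j, ψ j + (1 - c) • ψ k := by
  simpa [Pi.single_apply] using sum_projOf_mulVec_sum_smul hψ (Pi.single k 1)

theorem sum_projOf_kronecker_mulVec_sum_smul
    (hψ : ∀ i j, star (ψ i) ⬝ᵥ ψ j = if i = j then 1 else c)
    (a : Fin N → ℂ) :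
    (∑ k, projOf ψ k ⊗ₖ projOf ψ k) *ᵥ ∑ j, a j • kroneckerVec (ψ j) (ψ j) =
      (c ^ 2 * ∑ j, a j) • ∑ j, kroneckerVec (ψ j) (ψ j) +
        (1 - c ^ 2) • ∑ j, a j • kroneckerVec (ψ j) (ψ j) := by
  rw [sum_projOf_kronecker_mulVec]
  simp only [star_dotProduct_sum_smul (f := fun k => kroneckerVec (ψ k) (ψ k))
    (star_kroneckerVec_self_dotProduct hψ), add_smul, Finset.sum_add_distrib, mul_smul,
    Finset.smul_sum]

theorem sum_projOf_kronecker_mulVec_kroneckerVec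
    (hψ : ∀ i j, star (ψ i) ⬝ᵥ ψ j = if i = j then 1 else c)
    (a b : Fin N → ℂ) :
    (∑ k, projOf ψ k ⊗ₖ projOf ψ k) *ᵥ kroneckerVec (∑ j, a j • ψ j) (∑ j, b j • ψ j) =
      ∑ k, ((c * ∑ j, a j + (1 - c) * a k) * (c * ∑ j, b j + (1 - c) * b k)) •
        kroneckerVec (ψ k) (ψ k) := by
  rw [sum_projOf_kronecker_mulVec]
  simp only [star_kroneckerVec_dotProduct, star_dotProduct_sum_smul hψ]

theorem kronecker_sum_projOf_mulVec_sum_smul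
    (hψ : ∀ i j, star (ψ i) ⬝ᵥ ψ j = if i = j then 1 else c)
    (a : Fin N → ℂ) :
    ((∑ k, projOf ψ k) ⊗ₖ (∑ k, projOf ψ k)) *ᵥ ∑ j, a j • kroneckerVec (ψ j) (ψ j) =
      (1 - c) ^ 2 • ∑ j, a j • kroneckerVec (ψ j) (ψ j) +
      (c * (1 - c)) • (kroneckerVec (∑ j, a j • ψ j) (∑ j, ψ j) +
        kroneckerVec (∑ j, ψ j) (∑ j, a j • ψ j)) +
      (c ^ 2 * ∑ j, a j) • kroneckerVec (∑ j, ψ j) (∑ j, ψ j) := by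
  generalize hs : ∑ j, ψ j = s
  have h : ∀ k, kroneckerVec (c • s + (1 - c) • ψ k) (c • s + (1 - c) • ψ k) =
      (1 - c) ^ 2 • kroneckerVec (ψ k) (ψ k) +
      (c * (1 - c)) • (kroneckerVec (ψ k) s + kroneckerVec s (ψ k)) +
      c ^ 2 • kroneckerVec s s := by
    intro k
    simp only [map_add, map_smul, LinearMap.add_apply, LinearMap.smul_apply]
    module
  simp only [Matrix.mulVec_sum, Matrix.mulVec_smul, kronecker_mulVec_kroneckerVec,
    sum_projOf_mulVec_self hψ, hs, h, map_sum, map_smul, LinearMap.sum_apply, LinearMap.smul_apply,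
    Finset.mul_sum, Finset.sum_smul, Finset.smul_sum, ← Finset.sum_add_distrib]
  exact Finset.sum_congr rfl fun k _ => by module

/-- If `∑ a k = 0`, the vectors `∑ a k • (ψ k ⊗ ψ k)` and `w ⊗ s + s ⊗ w`, where `w = ∑ a k • ψ k`
and `s = ∑ ψ k`, span a common invariant subspace. -/
theorem exists_invariant_pair_of_sum_eq_zero
    (hψ : ∀ i j, star (ψ i) ⬝ᵥ ψ j = if i = j then 1 else c)
    (hc0 : c ≠ 0) (hc1 : 1 - c ≠ 0)
    {K : Submodule ℂ (Fin d × Fin d → ℂ)}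
    (hK : ∀ x ∈ K, ((∑ k, projOf ψ k) ⊗ₖ (∑ k, projOf ψ k)) *ᵥ x ∈ K)
    {a : Fin N → ℂ} (ha : ∑ j, a j = 0) {x : Fin d × Fin d → ℂ}
    (hx : x = ∑ j, a j • kroneckerVec (ψ j) (ψ j)) (hxK : x ∈ K) :
    ∃ y ∈ K,
      (∑ k, projOf ψ k ⊗ₖ projOf ψ k) *ᵥ x ∈ Submodule.span ℂ {x, y} ∧
      (∑ k, projOf ψ k ⊗ₖ projOf ψ k) *ᵥ y ∈ Submodule.span ℂ {x, y} ∧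
      ((∑ k, projOf ψ k) ⊗ₖ (∑ k, projOf ψ k)) *ᵥ x ∈ Submodule.span ℂ {x, y} ∧
      ((∑ k, projOf ψ k) ⊗ₖ (∑ k, projOf ψ k)) *ᵥ y ∈ Submodule.span ℂ {x, y} := by
  have hSx := sum_projOf_kronecker_mulVec_sum_smul hψ a
  have hRx := kronecker_sum_projOf_mulVec_sum_smul hψ a
  have hTw := sum_projOf_mulVec_sum_smul hψ a
  have hTs := sum_projOf_mulVec_sum hψ
  have hS₁ := sum_projOf_kronecker_mulVec_kroneckerVec hψ a (fun _ => 1)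
  have hS₂ := sum_projOf_kronecker_mulVec_kroneckerVec hψ (fun _ => 1) a
  have hsum : ∀ b : ℂ, ∑ k, (a k * b) • kroneckerVec (ψ k) (ψ k) = b • x := fun b => by
    simp only [hx, Finset.smul_sum, smul_smul, mul_comm]
  simp only [ha, mul_zero, zero_smul, zero_add, add_zero, ← hx, one_smul] at hSx hRx hTw hS₁ hS₂
  set w := ∑ j, a j • ψ j
  set s := ∑ j, ψ j
  set y := kroneckerVec w s + kroneckerVec s w with hy
  refine ⟨y, ?_, ?_, ?_, ?_, ?_⟩
  · have : y = (c * (1 - c))⁻¹ •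
        (((∑ k, projOf ψ k) ⊗ₖ (∑ k, projOf ψ k)) *ᵥ x - (1 - c) ^ 2 • x) := by
      rw [hRx, add_sub_cancel_left, smul_smul, inv_mul_cancel₀ (mul_ne_zero hc0 hc1), one_smul]
    rw [this]
    exact K.smul_mem _ (K.sub_mem (hK x hxK) (K.smul_mem _ hxK))
  · exact Submodule.mem_span_pair.2 ⟨1 - c ^ 2, 0, by rw [hSx]; simp⟩
  · refine Submodule.mem_span_pair.2 ⟨2 * (1 - c) * (c * N + (1 - c)), 0, ?_⟩
    rw [hy, Matrix.mulVec_add, hS₁, hS₂, zero_smul, add_zero, ← Finset.sum_add_distrib, ← hsum]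
    refine Finset.sum_congr rfl fun k _ => ?_
    rw [← add_smul]
    congr 1
    simp
    ring
  · exact Submodule.mem_span_pair.2 ⟨(1 - c) ^ 2, c * (1 - c), hRx.symm⟩
  · refine Submodule.mem_span_pair.2 ⟨0, (1 - c) * (c * N + (1 - c)), ?_⟩
    rw [hy, Matrix.mulVec_add, kronecker_mulVec_kroneckerVec, kronecker_mulVec_kroneckerVec,
      hTw, hTs]
    simp only [map_smul, LinearMap.smul_apply]
    module

/-- The vectors `∑ ψ k ⊗ ψ k` and `s ⊗ s`, where `s = ∑ ψ k`, span a common invariant subspace. -/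
theorem exists_invariant_pair_of_sum_mem
    (hψ : ∀ i j, star (ψ i) ⬝ᵥ ψ j = if i = j then 1 else c)
    (hc : 2 * (c * (1 - c)) + c ^ 2 * N ≠ 0)
    {K : Submodule ℂ (Fin d × Fin d → ℂ)}
    (hK : ∀ x ∈ K, ((∑ k, projOf ψ k) ⊗ₖ (∑ k, projOf ψ k)) *ᵥ x ∈ K)
    {x : Fin d × Fin d → ℂ} (hx : x = ∑ j, kroneckerVec (ψ j) (ψ j)) (hxK : x ∈ K) :
    ∃ y ∈ K,
      (∑ k, projOf ψ k ⊗ₖ projOf ψ k) *ᵥ x ∈ Submodule.span ℂ {x, y} ∧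
      (∑ k, projOf ψ k ⊗ₖ projOf ψ k) *ᵥ y ∈ Submodule.span ℂ {x, y} ∧
      ((∑ k, projOf ψ k) ⊗ₖ (∑ k, projOf ψ k)) *ᵥ x ∈ Submodule.span ℂ {x, y} ∧
      ((∑ k, projOf ψ k) ⊗ₖ (∑ k, projOf ψ k)) *ᵥ y ∈ Submodule.span ℂ {x, y} := by
  have hSx := sum_projOf_kronecker_mulVec_sum_smul hψ (fun _ => 1)
  have hRx := kronecker_sum_projOf_mulVec_sum_smul hψ (fun _ => 1)
  have hTs := sum_projOf_mulVec_sum hψ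
  have hSy := sum_projOf_kronecker_mulVec_kroneckerVec hψ (fun _ => 1) (fun _ => 1)
  simp only [one_smul, ← hx, Finset.sum_const, Finset.card_univ, Fintype.card_fin, nsmul_eq_mul,
    mul_one, ← Finset.smul_sum] at hSx hRx hSy
  set s := ∑ j, ψ j
  set y := kroneckerVec s s with hy
  have hRx' : ((∑ k, projOf ψ k) ⊗ₖ (∑ k, projOf ψ k)) *ᵥ x =
      (1 - c) ^ 2 • x + (2 * (c * (1 - c)) + c ^ 2 * N) • y := by
    rw [hRx]
    module
  refine ⟨y, ?_, ?_, ?_, ?_, ?_⟩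
  · have : y = (2 * (c * (1 - c)) + c ^ 2 * N)⁻¹ •
        (((∑ k, projOf ψ k) ⊗ₖ (∑ k, projOf ψ k)) *ᵥ x - (1 - c) ^ 2 • x) := by
      rw [hRx', add_sub_cancel_left, smul_smul, inv_mul_cancel₀ hc, one_smul]
    rw [this]
    exact K.smul_mem _ (K.sub_mem (hK x hxK) (K.smul_mem _ hxK))
  · exact Submodule.mem_span_pair.2 ⟨c ^ 2 * N + (1 - c ^ 2), 0, by rw [hSx]; module⟩
  · exact Submodule.mem_span_pair.2 ⟨(c * N + (1 - c)) ^ 2, 0, by rw [hSy]; module⟩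
  · exact Submodule.mem_span_pair.2 ⟨_, _, hRx'.symm⟩
  · refine Submodule.mem_span_pair.2 ⟨0, (c * N + (1 - c)) ^ 2, ?_⟩
    rw [hy, kronecker_mulVec_kroneckerVec, hTs]
    simp only [map_smul, LinearMap.smul_apply]
    module

end StateComparison

/-- The state-comparison operators `γ1` and `γ2` admit a two-dimensional common
block-diagonal structure: a finite family of pairwise orthogonal self-adjoint
projections, summing to the identity, each of rank at most `2`, all commuting with
`γ1` and `γ2`. -/
theorem state_comparison_has_2dCBS (d N : ℕ) (hN : 2 ≤ N) (ψ : Fin N → Fin d → ℂ)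
    (hnorm : ∀ k, star (ψ k) ⬝ᵥ ψ k = 1)
    (c : ℝ) (hc0 : 0 < c) (hc1 : c < 1)
    (hoverlap : ∀ i j, i ≠ j → star (ψ i) ⬝ᵥ ψ j = (c : ℂ)) :
    ∃ (m : ℕ) (Q : Fin m → Matrix (Fin d × Fin d) (Fin d × Fin d) ℂ),
      (∀ k, (Q k).IsHermitian) ∧
      (∀ k, Q k * Q k = Q k) ∧
      (∀ k l, k ≠ l → Q k * Q l = 0) ∧
      (∑ k, Q k = 1) ∧
      (∀ k, (Q k).rank ≤ 2) ∧
      (∀ k, Commute (Q k) (gammaOne ψ)) ∧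
      (∀ k, Commute (Q k) (gammaTwo ψ)) := by
  have hψ : ∀ i j, star (ψ i) ⬝ᵥ ψ j = if i = j then 1 else (c : ℂ) := by
    intro i j
    split_ifs with hij
    · rw [hij, hnorm]
    · exact hoverlap i j hij
  have hc : (c : ℂ) ≠ 0 := by exact_mod_cast hc0.ne'
  have hc' : 1 - (c : ℂ) ≠ 0 := by exact_mod_cast (sub_pos.2 hc1).ne'
  have hR : 2 * ((c : ℂ) * (1 - c)) + (c : ℂ) ^ 2 * N ≠ 0 := by
    have h1 : 0 < 1 - c := sub_pos.2 hc1
    have : 0 < 2 * (c * (1 - c)) + c ^ 2 * N := by positivity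
    exact_mod_cast this.ne'
  have hS : (c : ℂ) ^ 2 * N + (1 - (c : ℂ) ^ 2) ≠ 0 := by
    have h1 : 0 < 1 - c ^ 2 := by nlinarith
    have : 0 < c ^ 2 * N + (1 - c ^ 2) := by positivity
    exact_mod_cast this.ne'
  obtain ⟨m, Q, hQ, hQQ, hQ0, hQ1, hQr, hQS, hQR⟩ :=
    exists_commuting_projections_of_invariant_pairs (isHermitian_sum_projOf_kronecker ψ)
      (isHermitian_kronecker_sum_projOf ψ) (fun K hK hKS hKR => by
    by_cases hzero : ∀ z ∈ K, (∑ k, projOf ψ k ⊗ₖ projOf ψ k) *ᵥ z = 0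
    · obtain ⟨x, hxK, hx0, μ, hμ⟩ := exists_eigenvector_mem hK hKR
      refine ⟨x, hxK, x, hxK, hx0, ?_⟩
      rw [hzero x hxK, hμ]
      have hx : μ • x ∈ Submodule.span ℂ {x, x} :=
        Submodule.smul_mem _ _ (Submodule.subset_span (by simp))
      exact ⟨zero_mem _, zero_mem _, hx, hx⟩
    · push Not at hzero
      obtain ⟨z, hzK, hz0⟩ := hzero
      obtain ⟨a, hx⟩ : ∃ a : Fin N → ℂ, (∑ k, projOf ψ k ⊗ₖ projOf ψ k) *ᵥ z =
          ∑ k, a k • kroneckerVec (ψ k) (ψ k) := ⟨_, sum_projOf_kronecker_mulVec ψ z⟩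
      have hxK := hKS z hzK
      generalize (∑ k, projOf ψ k ⊗ₖ projOf ψ k) *ᵥ z = x at hz0 hx hxK
      by_cases ha : ∑ k, a k = 0
      · obtain ⟨y, hyK, hy⟩ := exists_invariant_pair_of_sum_eq_zero hψ hc hc' hKR ha hx hxK
        exact ⟨x, hxK, y, hyK, hz0, hy⟩
      · have huK : ∑ j, kroneckerVec (ψ j) (ψ j) ∈ K := by
          have h := hKS x hxK
          rw [hx, sum_projOf_kronecker_mulVec_sum_smul hψ, ← hx] at h
          exact (K.smul_mem_iff (mul_ne_zero (pow_ne_zero 2 hc) ha)).1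
            ((K.add_mem_iff_left (K.smul_mem _ hxK)).1 h)
        obtain ⟨y, hyK, hy⟩ := exists_invariant_pair_of_sum_mem hψ hR hKR rfl huK
        refine ⟨_, huK, y, hyK, fun h0 => hS ?_, hy⟩
        have h := star_dotProduct_sum_smul (f := fun k => kroneckerVec (ψ k) (ψ k))
          (star_kroneckerVec_self_dotProduct hψ) (fun _ => 1) ⟨0, by omega⟩
        simpa [h0] using h.symm)
  refine ⟨m, Q, hQ, hQQ, hQ0, hQ1, hQr, fun k => (hQS k).smul_right _, fun k => ?_⟩
  rw [gammaTwo_eq]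
  exact ((hQR k).sub_right (hQS k)).smul_right _
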